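/- Let γ₁, γ₂, γ₃ ∈ ℝ and let U(x) = R_x(x)R_y(x)R_z(x) be the three-dimensional rotation matrix with all three Euler angles equal to x, i.e., the matrix with rows (cos²x, cos x sin x, −sin x), (cos x sin²x − cos x sin x, cos²x + sin³x, cos x sin x), (cos²x sin x + sin²x, cos x sin²x − cos x sin x, cos²x). Define W(x) = U(x) · diag(|x|^{γ₁}, |x|^{γ₂}, |x|^{γ₃}) · U(x)ᵀ. Then W is an A₂ matrix weight if and only if γ₁ = γ₂ = γ₃ and −1 < γ₁ < 1. -/

import Mathlib

open MeasureTheory Matrix Real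

/-- The entrywise average `⟨W⟩_I` of a real matrix function over the interval `(a, b)`. -/
noncomputable def matrixAvgR (n : ℕ) (W : ℝ → Matrix (Fin n) (Fin n) ℝ) (a b : ℝ) :
    Matrix (Fin n) (Fin n) ℝ :=
  Matrix.of fun i j => (b - a)⁻¹ • ∫ x in a..b, W x i j

/-- A real matrix function `W` is an `A₂` matrix weight: it is positive definite a.e.,
the entries of `W` and `W⁻¹` are locally integrable, and
`sup_I Trace(⟨W⟩_I ⟨W⁻¹⟩_I) < ∞`, over all bounded intervals of positive length. -/
def IsA2MatrixWeightR (n : ℕ) (W : ℝ → Matrix (Fin n) (Fin n) ℝ) : Prop :=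
  (∀ᵐ x : ℝ, (W x).PosDef) ∧
  (∀ i j : Fin n, LocallyIntegrable (fun x => W x i j) volume) ∧
  (∀ i j : Fin n, LocallyIntegrable (fun x => (W x)⁻¹ i j) volume) ∧
  ∃ C : ℝ, ∀ a b : ℝ, a < b →
    (matrixAvgR n W a b * matrixAvgR n (fun x => (W x)⁻¹) a b).trace ≤ C

lemma MeasureTheory.LocallyIntegrable.intervalIntegrable_real {f : ℝ → ℝ}
    (h : LocallyIntegrable f volume) (a b : ℝ) : IntervalIntegrable f volume a b :=
  (h.integrableOn_isCompact isCompact_uIcc).intervalIntegrable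

lemma integral_trace_mul {n : ℕ} (A : Matrix (Fin n) (Fin n) ℝ)
    {G : ℝ → Matrix (Fin n) (Fin n) ℝ} {a b : ℝ}
    (hG : ∀ i j, IntervalIntegrable (fun x => G x i j) volume a b) :
    ∫ y in a..b, (A * G y).trace = ∑ i, ∑ j, A i j * ∫ y in a..b, G y j i := by
  simp only [Matrix.trace, Matrix.diag, Matrix.mul_apply]
  rw [intervalIntegral.integral_finsetSum]
  · refine Finset.sum_congr rfl fun i _ => ?_
    rw [intervalIntegral.integral_finsetSum]
    · simp only [intervalIntegral.integral_const_mul]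
    · exact fun j _ => (hG j i).const_mul (A i j)
  · intro i _
    simpa only [Finset.sum_fn] using
      IntervalIntegrable.sum Finset.univ fun j _ => (hG j i).const_mul (A i j)

/-- A lower bound for `Trace(⟨F⟩_I ⟨G⟩_I)`, obtained by writing it as a double integral. -/
lemma integral_le_trace_matrixAvgR_mul {n : ℕ} {F G : ℝ → Matrix (Fin n) (Fin n) ℝ} {a b : ℝ}
    (hab : a ≤ b)
    (hF : ∀ i j, IntervalIntegrable (fun x => F x i j) volume a b)
    (hG : ∀ i j, IntervalIntegrable (fun x => G x i j) volume a b)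
    {h : ℝ → ℝ → ℝ} (hc : Continuous (Function.uncurry h))
    (hle : ∀ x ∈ Set.Icc a b, ∀ y ∈ Set.Icc a b, h x y ≤ (F x * G y).trace) :
    ((b - a)⁻¹) ^ 2 * ∫ x in a..b, ∫ y in a..b, h x y ≤
      (matrixAvgR n F a b * matrixAvgR n G a b).trace := by
  have sum_int : ∀ i, IntervalIntegrable (fun x => ∑ j, F x i j * ∫ y in a..b, G y j i)
      volume a b := fun i => by
    simpa only [Finset.sum_fn] using IntervalIntegrable.sum Finset.univ fun j _ =>
      (hF i j).mul_const (∫ y in a..b, G y j i)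
  have trace_eq : (matrixAvgR n F a b * matrixAvgR n G a b).trace =
      ((b - a)⁻¹) ^ 2 * ∫ x in a..b, ∑ i, ∑ j, F x i j * ∫ y in a..b, G y j i := by
    rw [intervalIntegral.integral_finsetSum fun i _ => sum_int i]
    simp only [Matrix.trace, Matrix.diag, Matrix.mul_apply, matrixAvgR, Matrix.of_apply,
      smul_eq_mul, Finset.mul_sum]
    refine Finset.sum_congr rfl fun i _ => ?_
    rw [intervalIntegral.integral_finsetSum fun j _ => (hF i j).mul_const _, Finset.mul_sum]
    refine Finset.sum_congr rfl fun j _ => ?_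
    rw [intervalIntegral.integral_mul_const]
    ring
  rw [trace_eq]
  gcongr
  refine intervalIntegral.integral_mono_on hab
    (intervalIntegral.continuous_parametric_intervalIntegral_of_continuous' hc a b
      |>.intervalIntegrable _ _) ?_ fun x hx => ?_
  · simpa only [Finset.sum_fn] using IntervalIntegrable.sum Finset.univ fun i _ => sum_int i
  · rw [← integral_trace_mul _ hG]
    refine intervalIntegral.integral_mono_on hab
      ((hc.comp (Continuous.prodMk_right x)).intervalIntegrable _ _) ?_ fun y hy => hle x hx y hy
    simp only [Matrix.trace, Matrix.diag, Matrix.mul_apply]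
    have row_int : ∀ i, IntervalIntegrable (fun y => ∑ j, F x i j * G y j i) volume a b :=
      fun i => by
        simpa only [Finset.sum_fn] using
          IntervalIntegrable.sum Finset.univ fun j _ => (hG j i).const_mul (F x i j)
    simpa only [Finset.sum_fn] using IntervalIntegrable.sum Finset.univ fun i _ => row_int i

lemma trace_conj_diagonal_mul_conj_diagonal {ι : Type*} [Fintype ι] [DecidableEq ι]
    (A B : Matrix ι ι ℝ) (d e : ι → ℝ) :
    (A * diagonal d * Aᵀ * (B * diagonal e * Bᵀ)).trace =
      ∑ k, ∑ l, d k * e l * ((Aᵀ * B) k l) ^ 2 := by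
  have h : (A * diagonal d * Aᵀ * (B * diagonal e * Bᵀ)).trace =
      (diagonal d * (Aᵀ * B) * (diagonal e * (Aᵀ * B)ᵀ)).trace := by
    rw [Matrix.transpose_mul, Matrix.transpose_transpose, Matrix.mul_assoc, Matrix.mul_assoc,
      Matrix.trace_mul_comm]
    simp only [Matrix.mul_assoc]
  rw [h]
  simp only [Matrix.trace, Matrix.diag]
  refine Finset.sum_congr rfl fun k _ => ?_
  rw [Matrix.mul_apply]
  refine Finset.sum_congr rfl fun l _ => ?_
  rw [Matrix.diagonal_mul, Matrix.diagonal_mul, Matrix.transpose_apply]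
  ring

lemma le_trace_conj_diagonal_mul_conj_diagonal {ι : Type*} [Fintype ι] [DecidableEq ι]
    (A B : Matrix ι ι ℝ) {d e : ι → ℝ} (hd : ∀ i, 0 ≤ d i) (he : ∀ i, 0 ≤ e i) (k l : ι) :
    d k * e l * ((Aᵀ * B) k l) ^ 2 ≤ (A * diagonal d * Aᵀ * (B * diagonal e * Bᵀ)).trace := by
  rw [trace_conj_diagonal_mul_conj_diagonal]
  have h : ∀ i j, 0 ≤ d i * e j * ((Aᵀ * B) i j) ^ 2 := fun i j =>
    mul_nonneg (mul_nonneg (hd i) (he j)) (sq_nonneg _)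
  exact (Finset.single_le_sum (f := fun j => d k * e j * ((Aᵀ * B) k j) ^ 2)
    (fun j _ => h k j) (Finset.mem_univ l)).trans
    (Finset.single_le_sum (f := fun i => ∑ j, d i * e j * ((Aᵀ * B) i j) ^ 2)
      (fun i _ => Finset.sum_nonneg fun j _ => h i j) (Finset.mem_univ k))

lemma locallyIntegrable_abs_rpow {γ : ℝ} (hγ : -1 < γ) :
    LocallyIntegrable (fun x : ℝ => |x| ^ γ) volume := by
  refine locallyIntegrable_of_norm_le_rpow (C := 1) (α := -γ) (by simp) (by simp; linarith)
    (Filter.Eventually.of_forall fun x => ?_)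
    (measurable_id.abs.pow_const γ).aestronglyMeasurable
  rw [neg_neg, one_mul, Real.norm_eq_abs, Real.norm_eq_abs, abs_of_nonneg (by positivity)]

lemma intervalIntegrable_abs_rpow {γ : ℝ} (hγ : -1 < γ) (a b : ℝ) :
    IntervalIntegrable (fun x : ℝ => |x| ^ γ) volume a b :=
  (locallyIntegrable_abs_rpow hγ).intervalIntegrable_real a b

lemma integral_abs_rpow_symm {γ r : ℝ} (hγ : -1 < γ) (hr : 0 ≤ r) :
    ∫ x in -r..r, |x| ^ γ = 2 * (r ^ (γ + 1) / (γ + 1)) := by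
  have h0 : ∫ x in (0 : ℝ)..r, |x| ^ γ = r ^ (γ + 1) / (γ + 1) := by
    rw [intervalIntegral.integral_congr (g := fun x => x ^ γ), integral_rpow (Or.inl hγ),
      Real.zero_rpow (by linarith), sub_zero]
    intro x hx
    rw [Set.uIcc_of_le hr] at hx
    simp only [abs_of_nonneg hx.1]
  have h1 : ∫ x in -r..0, |x| ^ γ = ∫ x in (0 : ℝ)..r, |x| ^ γ := by
    have := intervalIntegral.integral_comp_neg (a := 0) (b := r) (fun x : ℝ => |x| ^ γ)
    simpa using this.symm
  rw [← intervalIntegral.integral_add_adjacent_intervals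
    (intervalIntegrable_abs_rpow hγ _ _) (intervalIntegrable_abs_rpow hγ _ _), h1, h0]
  ring

/-- A power weight with nonpositive exponent `-γ > -1` is an `A₁` weight, quantitatively. -/
lemma integral_abs_rpow_neg_le {γ a b : ℝ} (h0 : 0 ≤ γ) (h1 : γ < 1) (hab : a < b) :
    ∫ x in a..b, |x| ^ (-γ) ≤ 4 / (1 - γ) * ((b - a) * (max |a| |b|) ^ (-γ)) := by
  set r := max |a| |b| with hr
  have har : |a| ≤ r := le_max_left _ _
  have hbr : |b| ≤ r := le_max_right _ _
  have hr0 : 0 < r := by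
    rcases eq_or_ne a 0 with ha | ha
    · exact (abs_pos.2 (ha ▸ hab).ne').trans_le hbr
    · exact (abs_pos.2 ha).trans_le har
  have hγ : 0 < 1 - γ := by linarith
  have hint := intervalIntegrable_abs_rpow (γ := -γ) (by linarith)
  have hrp : 0 < r ^ (-γ) := Real.rpow_pos_of_pos hr0 _
  rcases le_total (r / 2) (b - a) with h | h
  · calc ∫ x in a..b, |x| ^ (-γ) ≤ ∫ x in -r..r, |x| ^ (-γ) :=
          intervalIntegral.integral_mono_interval (neg_le_of_abs_le har) hab.le (le_of_abs_le hbr)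
            (Filter.Eventually.of_forall fun x => by simp only [Pi.zero_apply]; positivity)
            (hint _ _)
      _ = 4 / (1 - γ) * (r / 2 * r ^ (-γ)) := by
          rw [integral_abs_rpow_symm (by linarith) hr0.le, Real.rpow_add_one hr0.ne',
            show -γ + 1 = 1 - γ by ring]
          ring
      _ ≤ _ := by gcongr
  · have hx : ∀ x ∈ Set.Icc a b, |x| ^ (-γ) ≤ 4 / (1 - γ) * r ^ (-γ) := by
      intro x hx
      have hxr : r / 2 ≤ |x| := by
        rcases max_choice |a| |b| with h' | h'
        · have : |a| ≤ |x| + (b - a) := by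
            rw [abs_le]; constructor <;> [linarith [neg_abs_le x, hx.1, hx.2];
              linarith [le_abs_self x, hx.1, hx.2]]
          linarith [hr.trans h']
        · have : |b| ≤ |x| + (b - a) := by
            rw [abs_le]; constructor <;> [linarith [neg_abs_le x, hx.1, hx.2];
              linarith [le_abs_self x, hx.1, hx.2]]
          linarith [hr.trans h']
      calc |x| ^ (-γ) ≤ (r / 2) ^ (-γ) :=
            Real.rpow_le_rpow_of_nonpos (by positivity) hxr (by linarith)
        _ = 2 ^ γ * r ^ (-γ) := by
            rw [Real.div_rpow hr0.le (by norm_num), Real.rpow_neg (by norm_num : (0:ℝ) ≤ 2),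
              div_inv_eq_mul, mul_comm]
        _ ≤ 4 / (1 - γ) * r ^ (-γ) := by
            gcongr
            calc (2 : ℝ) ^ γ ≤ 2 ^ (1 : ℝ) :=
                  Real.rpow_le_rpow_of_exponent_le (by norm_num) h1.le
              _ ≤ 4 := by norm_num
              _ ≤ 4 / (1 - γ) := by rw [le_div_iff₀ hγ]; linarith
    calc ∫ x in a..b, |x| ^ (-γ) ≤ ∫ _ in a..b, 4 / (1 - γ) * r ^ (-γ) :=
          intervalIntegral.integral_mono_on hab.le (hint _ _) (by simp) hx
      _ = _ := by rw [intervalIntegral.integral_const, smul_eq_mul]; ring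

/-- The scalar power weight `|x| ^ γ`, `-1 < γ < 1`, is an `A₂` weight. -/
lemma exists_integral_abs_rpow_mul_le {γ : ℝ} (h0 : -1 < γ) (h1 : γ < 1) :
    ∃ C : ℝ, ∀ a b : ℝ, a < b →
      (∫ x in a..b, |x| ^ γ) * (∫ x in a..b, |x| ^ (-γ)) ≤ C * (b - a) ^ 2 := by
  wlog h : 0 ≤ γ generalizing γ with hwlog
  · obtain ⟨C, hC⟩ := hwlog (γ := -γ) (by linarith) (by linarith) (by linarith)
    refine ⟨C, fun a b hab => ?_⟩
    rw [mul_comm]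
    simpa using hC a b hab
  refine ⟨4 / (1 - γ), fun a b hab => ?_⟩
  have hr0 : 0 < max |a| |b| := by
    by_contra! hcon
    have ha := (le_max_left |a| |b|).trans hcon
    have hb := (le_max_right |a| |b|).trans hcon
    linarith [neg_abs_le a, le_abs_self b]
  have hup : ∫ x in a..b, |x| ^ γ ≤ (b - a) * (max |a| |b|) ^ γ := by
    calc ∫ x in a..b, |x| ^ γ ≤ ∫ _ in a..b, (max |a| |b|) ^ γ :=
          intervalIntegral.integral_mono_on hab.le (intervalIntegrable_abs_rpow h0 _ _) (by simp)
            fun x hx => Real.rpow_le_rpow (abs_nonneg _) (abs_le_max_abs_abs hx.1 hx.2) h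
      _ = _ := by rw [intervalIntegral.integral_const, smul_eq_mul]
  have hpos : 0 ≤ ∫ x in a..b, |x| ^ (-γ) :=
    intervalIntegral.integral_nonneg hab.le fun x _ => by positivity
  have hba : 0 ≤ b - a := by linarith
  refine (mul_le_mul hup (integral_abs_rpow_neg_le h h1 hab) hpos (by positivity)).trans_eq ?_
  rw [Real.rpow_neg hr0.le]
  have := (Real.rpow_pos_of_pos hr0 γ).ne'
  field_simp

lemma rpow_div_two_le {γ T x : ℝ} (h0 : -1 < γ) (hT : 0 < T) (hx : T ≤ x)
    (hx' : x ≤ 2 * T) : T ^ γ / 2 ≤ x ^ γ := by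
  have hTγ := Real.rpow_pos_of_pos hT γ
  rcases le_total 0 γ with h | h
  · linarith [Real.rpow_le_rpow hT.le hx h]
  · calc T ^ γ / 2 = 2 ^ (-1 : ℝ) * T ^ γ := by rw [Real.rpow_neg_one]; ring
      _ ≤ 2 ^ γ * T ^ γ := by gcongr; norm_num
      _ = (2 * T) ^ γ := (Real.mul_rpow (by norm_num) hT.le).symm
      _ ≤ x ^ γ := Real.rpow_le_rpow_of_nonpos (hT.trans_le hx) hx' h

lemma neg_one_lt_of_locallyIntegrable_conj_diagonal {n : ℕ} {U V : ℝ → Matrix (Fin n) (Fin n) ℝ}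
    (hU : ∀ x, (U x)ᵀ * U x = 1) {γ : Fin n → ℝ}
    (hV : ∀ x, 0 < x → V x = U x * diagonal (fun k => x ^ γ k) * (U x)ᵀ)
    (h : ∀ i, LocallyIntegrable (fun x => V x i i) volume) (k : Fin n) : -1 < γ k := by
  rw [← intervalIntegral.integrableOn_Ioo_rpow_iff one_pos]
  have hsum : IntegrableOn (fun x => ∑ i, V x i i) (Set.Ioo 0 1) :=
    integrable_finsetSum _ fun i _ =>
      ((h i).integrableOn_isCompact (isCompact_Icc (a := (0 : ℝ)) (b := 1))).mono_set
        Set.Ioo_subset_Icc_self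
  refine Integrable.mono' hsum (measurable_id.pow_const (γ k)).aestronglyMeasurable
    (ae_restrict_of_forall_mem measurableSet_Ioo fun x hx => ?_)
  have htr : ∑ i, V x i i = ∑ j, x ^ γ j := by
    change (V x).trace = _
    rw [hV x hx.1, Matrix.trace_mul_comm, ← Matrix.mul_assoc, hU, Matrix.one_mul,
      Matrix.trace_diagonal]
  have hnn : ∀ j, 0 ≤ x ^ γ j := fun j => Real.rpow_nonneg hx.1.le _
  rw [htr, Real.norm_of_nonneg (hnn k)]
  exact Finset.single_le_sum (f := fun j => x ^ γ j) (fun j _ => hnn j) (Finset.mem_univ k)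

lemma conj_diagonal_rpow_inv {n : ℕ} {A : Matrix (Fin n) (Fin n) ℝ} (hA : Aᵀ * A = 1)
    (γ : Fin n → ℝ) {x : ℝ} (hx : 0 < x) :
    (A * diagonal (fun k => x ^ γ k) * Aᵀ)⁻¹ = A * diagonal (fun k => x ^ (-γ k)) * Aᵀ := by
  refine Matrix.inv_eq_right_inv ?_
  calc A * diagonal (fun k => x ^ γ k) * Aᵀ * (A * diagonal (fun k => x ^ (-γ k)) * Aᵀ)
      = A * diagonal (fun k => x ^ γ k) * (Aᵀ * A) * diagonal (fun k => x ^ (-γ k)) * Aᵀ := by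
        simp only [Matrix.mul_assoc]
    _ = A * (diagonal (fun k => x ^ γ k) * diagonal (fun k => x ^ (-γ k))) * Aᵀ := by
        rw [hA, Matrix.mul_one, Matrix.mul_assoc A]
    _ = 1 := by
        have h : (fun k => x ^ γ k * x ^ (-γ k)) = fun _ => (1 : ℝ) := by
          funext k
          rw [← Real.rpow_add hx, add_neg_cancel, Real.rpow_zero]
        rw [Matrix.diagonal_mul_diagonal, h, Matrix.diagonal_one, Matrix.mul_one,
          mul_eq_one_comm.1 hA]

/-- If a `2π`-periodic rotation `U` mixes the `k`-th and `l`-th axes, the power weight conjugated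
by `U` can only be an `A₂` weight if `γ k ≤ γ l`: test on `(2πN, 2πN + 2π)` as `N → ∞`. -/
lemma exponent_le_of_isA2MatrixWeightR {n : ℕ} {U W : ℝ → Matrix (Fin n) (Fin n) ℝ}
    (hU : ∀ x, (U x)ᵀ * U x = 1) (hcont : ∀ i j, Continuous fun x => U x i j)
    (hper : Function.Periodic U (2 * π)) {γ : Fin n → ℝ}
    (hW : ∀ x, 0 < x → W x = U x * diagonal (fun k => x ^ γ k) * (U x)ᵀ)
    (h : IsA2MatrixWeightR n W) (hγ : ∀ k, -1 < γ k ∧ γ k < 1) {k l : Fin n}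
    {s t : ℝ} (hs : s ∈ Set.Icc 0 (2 * π)) (ht : t ∈ Set.Icc 0 (2 * π))
    (hst : ((U s)ᵀ * U t) k l ≠ 0) : γ k ≤ γ l := by
  obtain ⟨-, hint, hint', C, hC⟩ := h
  set g : ℝ → ℝ → ℝ := fun x y => (((U x)ᵀ * U y) k l) ^ 2 with hg
  have hgc : Continuous (Function.uncurry g) := by
    simp only [hg, Matrix.mul_apply, Matrix.transpose_apply, Function.uncurry_def]
    exact (continuous_finsetSum _ fun i _ => ((hcont i k).comp continuous_fst).mul
      ((hcont i l).comp continuous_snd)).pow 2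
  have hπ := Real.two_pi_pos
  have hIc := intervalIntegral.continuous_parametric_intervalIntegral_of_continuous'
    (μ := volume) hgc 0 (2 * π)
  set c := ∫ x in (0 : ℝ)..2 * π, ∫ y in (0 : ℝ)..2 * π, g x y with hcdef
  have hc : 0 < c := by
    refine intervalIntegral.integral_pos hπ hIc.continuousOn
      (fun x _ => intervalIntegral.integral_nonneg hπ.le fun y _ => sq_nonneg _) ⟨s, hs, ?_⟩
    exact intervalIntegral.integral_pos hπ
      (hgc.comp (Continuous.prodMk_right s)).continuousOn (fun y _ => sq_nonneg _)
      ⟨t, ht, by positivity⟩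
  have key : ∀ N : ℕ, 1 ≤ N →
      ((2 * π)⁻¹) ^ 2 * (((N * (2 * π)) ^ (γ k - γ l) / 4) * c) ≤ C := by
    intro N hN
    have hN' : (1 : ℝ) ≤ N := by exact_mod_cast hN
    set T := N * (2 * π) with hTdef
    have hTπ : 2 * π ≤ T := by nlinarith
    have hT : 0 < T := by linarith
    have hshift : ∫ x in T..T + 2 * π, ∫ y in T..T + 2 * π, T ^ (γ k - γ l) / 4 * g x y =
        T ^ (γ k - γ l) / 4 * c := by
      have hy : ∀ x, ∫ y in T..T + 2 * π, g x y = ∫ y in (0 : ℝ)..2 * π, g x y := fun x => by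
        have hp : Function.Periodic (g x) (2 * π) := fun y => by simp only [hg, hper y]
        simpa using hp.intervalIntegral_add_eq T 0
      have hp : Function.Periodic (fun x => ∫ y in (0 : ℝ)..2 * π, g x y) (2 * π) := fun x => by
        simp only [hg, hper x]
      simp only [intervalIntegral.integral_const_mul, hy]
      rw [hp.intervalIntegral_add_eq T 0, zero_add]
    have hgc' : Continuous (Function.uncurry fun x y => T ^ (γ k - γ l) / 4 * g x y) :=
      (continuous_const (y := T ^ (γ k - γ l) / 4)).mul hgc
    have hlow := integral_le_trace_matrixAvgR_mul (F := W) (G := fun x => (W x)⁻¹)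
      (h := fun x y => T ^ (γ k - γ l) / 4 * g x y)
      (show T ≤ T + 2 * π by linarith)
      (fun i j => (hint i j).intervalIntegrable_real _ _)
      (fun i j => (hint' i j).intervalIntegrable_real _ _)
      hgc' (fun x hx y hy => ?_)
    · rw [hshift, add_sub_cancel_left] at hlow
      exact hlow.trans (hC _ _ (by linarith))
    · have hx0 : 0 < x := hT.trans_le hx.1
      have hy0 : 0 < y := hT.trans_le hy.1
      rw [hW x hx0, hW y hy0, conj_diagonal_rpow_inv (hU y) γ hy0]
      refine le_trans ?_ (le_trace_conj_diagonal_mul_conj_diagonal (U x) (U y)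
        (fun i => Real.rpow_nonneg hx0.le _) (fun i => Real.rpow_nonneg hy0.le _) k l)
      refine mul_le_mul_of_nonneg_right ?_ (sq_nonneg _)
      have h1 := rpow_div_two_le (hγ k).1 hT hx.1 (by linarith [hx.2])
      have h2 := rpow_div_two_le (γ := -γ l) (by linarith [(hγ l).2]) hT hy.1 (by linarith [hy.2])
      calc T ^ (γ k - γ l) / 4 = T ^ γ k / 2 * (T ^ (-γ l) / 2) := by
            rw [sub_eq_add_neg, Real.rpow_add hT]; ring
        _ ≤ _ := mul_le_mul h1 h2 (by positivity) (by positivity)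
  by_contra! hlt
  have htend : Filter.Tendsto
      (fun N : ℕ => ((2 * π)⁻¹) ^ 2 * (((N * (2 * π)) ^ (γ k - γ l) / 4) * c))
      Filter.atTop Filter.atTop := by
    refine Filter.Tendsto.const_mul_atTop (by positivity) (Filter.Tendsto.atTop_mul_const hc
      (Filter.Tendsto.atTop_div_const (by norm_num) ?_))
    exact (tendsto_rpow_atTop (sub_pos.2 hlt)).comp
      (tendsto_natCast_atTop_atTop.atTop_mul_const hπ)
  obtain ⟨N, hN, hN1⟩ := ((htend.eventually_gt_atTop C).and (Filter.eventually_ge_atTop 1)).exists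
  exact absurd (key N hN1) (not_le.2 hN)

/-- The scalar weight `|x| ^ γ` times the identity is an `A₂` matrix weight. -/
lemma isA2MatrixWeightR_diagonal_abs_rpow (n : ℕ) {γ : ℝ} (h0 : -1 < γ) (h1 : γ < 1) :
    IsA2MatrixWeightR n fun x => diagonal fun _ => |x| ^ γ := by
  have hinv : ∀ x : ℝ, (diagonal fun _ : Fin n => |x| ^ γ)⁻¹ = diagonal fun _ => |x| ^ (-γ) := by
    intro x
    rw [Real.rpow_neg (abs_nonneg x)]
    rcases eq_or_ne (|x| ^ γ) 0 with h | h
    · simp [h]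
    · refine Matrix.inv_eq_right_inv ?_
      simp [Matrix.diagonal_mul_diagonal, mul_inv_cancel₀ h]
  have hloc : ∀ {δ : ℝ}, -1 < δ → ∀ i j : Fin n,
      LocallyIntegrable (fun x : ℝ => (diagonal fun _ : Fin n => |x| ^ δ) i j) volume := by
    intro δ hδ i j
    rcases eq_or_ne i j with rfl | hij
    · simpa only [Matrix.diagonal_apply_eq] using locallyIntegrable_abs_rpow hδ
    · simpa only [Matrix.diagonal_apply_ne _ hij] using locallyIntegrable_zero
  have havg : ∀ (δ a b : ℝ), matrixAvgR n (fun x => diagonal fun _ => |x| ^ δ) a b =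
      diagonal fun _ => (b - a)⁻¹ * ∫ x in a..b, |x| ^ δ := by
    intro δ a b
    ext i j
    rcases eq_or_ne i j with rfl | hij
    · simp [matrixAvgR]
    · simp [matrixAvgR, hij]
  refine ⟨?_, hloc h0, ?_, ?_⟩
  · filter_upwards [Measure.ae_ne volume (0 : ℝ)] with x hx
    exact Matrix.PosDef.diagonal fun _ => Real.rpow_pos_of_pos (abs_pos.2 hx) _
  · simpa only [hinv] using hloc (δ := -γ) (by linarith)
  · obtain ⟨C, hC⟩ := exists_integral_abs_rpow_mul_le h0 h1
    refine ⟨n * C, fun a b hab => ?_⟩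
    have hba : 0 < b - a := sub_pos.2 hab
    simp only [hinv, havg, Matrix.diagonal_mul_diagonal, Matrix.trace_diagonal, Finset.sum_const,
      Finset.card_univ, Fintype.card_fin, nsmul_eq_mul]
    gcongr
    calc (b - a)⁻¹ * (∫ x in a..b, |x| ^ γ) * ((b - a)⁻¹ * ∫ x in a..b, |x| ^ (-γ))
        = ((∫ x in a..b, |x| ^ γ) * ∫ x in a..b, |x| ^ (-γ)) / (b - a) ^ 2 := by field_simp
      _ ≤ C := (div_le_iff₀ (by positivity)).2 (hC a b hab)

/-- The rotation matrix `R_x(x) R_y(x) R_z(x)` with all three Euler angles equal to `x`. -/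
noncomputable def eulerRotation (x : ℝ) : Matrix (Fin 3) (Fin 3) ℝ :=
  !![cos x ^ 2, cos x * sin x, -sin x;
     cos x * sin x ^ 2 - cos x * sin x, cos x ^ 2 + sin x ^ 3, cos x * sin x;
     cos x ^ 2 * sin x + sin x ^ 2, cos x * sin x ^ 2 - cos x * sin x, cos x ^ 2]

lemma eulerRotation_transpose_mul_self (x : ℝ) : (eulerRotation x)ᵀ * eulerRotation x = 1 := by
  have h := Real.sin_sq_add_cos_sq x
  ext i j
  fin_cases i <;> fin_cases j <;>
    simp [eulerRotation, Matrix.mul_apply, Fin.sum_univ_three] <;> grind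

lemma continuous_eulerRotation_apply (i j : Fin 3) : Continuous fun x => eulerRotation x i j := by
  fin_cases i <;> fin_cases j <;> simp [eulerRotation] <;> fun_prop

lemma periodic_eulerRotation : Function.Periodic eulerRotation (2 * π) := fun x => by
  simp only [eulerRotation, Real.cos_add_two_pi, Real.sin_add_two_pi]

lemma eulerRotation_zero : eulerRotation 0 = 1 := by
  ext i j
  fin_cases i <;> fin_cases j <;> simp [eulerRotation]

lemma eulerRotation_apply_ne_zero {x : ℝ} (hx : 0 < x) (hx' : x < π / 2) {i j : Fin 3}
    (hij : i ≠ j) : eulerRotation x i j ≠ 0 := by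
  have hc : 0 < cos x := Real.cos_pos_of_mem_Ioo ⟨by linarith, hx'⟩
  have hs : 0 < sin x := Real.sin_pos_of_pos_of_lt_pi hx (by linarith)
  have hs1 : sin x < 1 := by nlinarith [Real.sin_sq_add_cos_sq x]
  have hneg : cos x * sin x ^ 2 - cos x * sin x ≠ 0 := by
    have : cos x * sin x ^ 2 - cos x * sin x = -(cos x * sin x * (1 - sin x)) := by ring
    rw [this]
    have : 0 < 1 - sin x := by linarith
    exact neg_ne_zero.2 (by positivity)
  have hpos : cos x ^ 2 * sin x + sin x ^ 2 ≠ 0 := by positivity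
  fin_cases i <;> fin_cases j <;> first
    | exact absurd rfl hij
    | simpa [eulerRotation] using hneg
    | simpa [eulerRotation] using hpos
    | simp [eulerRotation, hc.ne', hs.ne']

/-- Let `U(x) = R_x(x) R_y(x) R_z(x)` be the three-dimensional rotation
matrix with all three Euler angles equal to `x`, and let
`W(x) = U(x) diag(|x|^γ₁, |x|^γ₂, |x|^γ₃) U(x)ᵀ`. Then `W` is an `A₂` matrix weight iff
`γ₁ = γ₂ = γ₃` and `-1 < γ₁ < 1`. -/
theorem rotation3d_power_isA2_iff (γ₁ γ₂ γ₃ : ℝ)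
    (U : ℝ → Matrix (Fin 3) (Fin 3) ℝ)
    (hU : ∀ x : ℝ, U x =
      !![cos x ^ 2, cos x * sin x, -sin x;
         cos x * sin x ^ 2 - cos x * sin x, cos x ^ 2 + sin x ^ 3, cos x * sin x;
         cos x ^ 2 * sin x + sin x ^ 2, cos x * sin x ^ 2 - cos x * sin x, cos x ^ 2])
    (W : ℝ → Matrix (Fin 3) (Fin 3) ℝ)
    (hW : ∀ x : ℝ, W x = U x * Matrix.diagonal ![|x| ^ γ₁, |x| ^ γ₂, |x| ^ γ₃] * (U x)ᵀ) :
    IsA2MatrixWeightR 3 W ↔ (γ₁ = γ₂ ∧ γ₂ = γ₃ ∧ -1 < γ₁ ∧ γ₁ < 1) := by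
  obtain rfl : U = eulerRotation := funext hU
  constructor
  · intro h
    have hΓ : ∀ x, 0 < x → W x = eulerRotation x *
        diagonal (fun k => x ^ (![γ₁, γ₂, γ₃] : Fin 3 → ℝ) k) * (eulerRotation x)ᵀ := by
      intro x hx
      rw [hW x, abs_of_pos hx]
      congr 3
      funext k
      fin_cases k <;> rfl
    generalize hΓdef : (![γ₁, γ₂, γ₃] : Fin 3 → ℝ) = Γ at hΓ
    have hU' := eulerRotation_transpose_mul_self
    have hlow := neg_one_lt_of_locallyIntegrable_conj_diagonal hU' hΓ fun i => h.2.1 i i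
    have hupp := neg_one_lt_of_locallyIntegrable_conj_diagonal (γ := fun k => -Γ k) hU'
      (fun x hx => by rw [hΓ x hx, conj_diagonal_rpow_inv (hU' x) Γ hx]) fun i => h.2.2.1 i i
    have hπ := Real.pi_pos
    have hle : ∀ k l, k ≠ l → Γ k ≤ Γ l := fun k l hkl =>
      exponent_le_of_isA2MatrixWeightR hU' continuous_eulerRotation_apply periodic_eulerRotation
        hΓ h (fun k => ⟨hlow k, by linarith [hupp k]⟩) (s := 0) (t := π / 4)
        ⟨le_rfl, by linarith⟩ ⟨by linarith, by linarith⟩ (by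
          rw [eulerRotation_zero, Matrix.transpose_one, Matrix.one_mul]
          exact eulerRotation_apply_ne_zero (by linarith) (by linarith) hkl)
    have h01 := le_antisymm (hle 0 1 (by decide)) (hle 1 0 (by decide))
    have h12 := le_antisymm (hle 1 2 (by decide)) (hle 2 1 (by decide))
    have hlow0 := hlow 0
    have hupp0 := hupp 0
    subst hΓdef
    exact ⟨h01, h12, hlow0, neg_lt_neg_iff.1 hupp0⟩
  · rintro ⟨rfl, rfl, h0, h1⟩
    have hW' : W = fun x => diagonal fun _ => |x| ^ γ₁ := by
      funext x
      have hconst : (![|x| ^ γ₁, |x| ^ γ₁, |x| ^ γ₁] : Fin 3 → ℝ) = fun _ => |x| ^ γ₁ := by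
        funext k
        fin_cases k <;> rfl
      rw [hW x, hconst, ← Matrix.smul_one_eq_diagonal, Matrix.mul_smul, Matrix.mul_one,
        Matrix.smul_mul, mul_eq_one_comm.1 (eulerRotation_transpose_mul_self x)]
    rw [hW']
    exact isA2MatrixWeightR_diagonal_abs_rpow 3 h0 h1
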